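/- arXiv:1702.08749 — 4 statements merged into one kernel-verified Lean document; each statement's English description precedes it below -/
import Mathlib

section
/- Let A be a good antichain of words in F. If θ₁ and θ₂ are fully invariant congruences on F belonging to L_A, then both θ₁ ⊓ θ₂ and θ₁ ⊔ θ₂ (meet and join taken in the lattice of congruences on F) are fully invariant congruences belonging to L_A. In particular, L_A is a sublattice of the lattice of fully invariant congruences on F. -/
/- `F` is the free monoid over a countably infinite alphabet. -/
abbrev F := FreeMonoid ℕ

/-- A congruence on `F` is fully invariant if it is preserved by all monoid
endomorphisms of `F`. -/
def FullyInvariant (θ : Con F) : Prop :=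
  ∀ ξ : F →* F, ∀ u v : F, θ u v → θ (ξ u) (ξ v)

open scoped Classical in
/-- The endomorphism of `F` deleting all letters from `X` and fixing the other letters. -/
noncomputable def deleteHom (X : Set ℕ) : F →* F :=
  FreeMonoid.lift (fun a => if a ∈ X then 1 else FreeMonoid.of a)

/-- The content of a word: the set of letters occurring in it. -/
def letters (w : F) : Set ℕ := {a | a ∈ FreeMonoid.toList w}

/-- The number of occurrences of the letter `x` in the word `w`. -/
def occ (x : ℕ) (w : F) : ℕ := (FreeMonoid.toList w).count x

/-- The commutativity congruence `κ` (as a binary relation): every letter occurs the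
same number of times in `u` as in `v`. -/
def kappaRel (u v : F) : Prop := ∀ x : ℕ, occ x u = occ x v

/-- An endomorphism is nonerasing if it sends every letter to a nonempty word. -/
def Nonerasing (ξ : F →* F) : Prop := ∀ a : ℕ, ξ (FreeMonoid.of a) ≠ 1

/-- `Preceq u v` iff `v = a * ξ u * b` for some words `a, b` and nonerasing `ξ`. -/
def Preceq (u v : F) : Prop :=
  ∃ a b : F, ∃ ξ : F →* F, Nonerasing ξ ∧ v = a * ξ u * b

/-- A set `A` of nonempty words is a good antichain if it is an antichain with respect
to `Preceq`, and any two members have the same content and become equal after deleting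
any nonempty subset of the content. -/
def GoodAntichain (A : Set F) : Prop :=
  (∀ u ∈ A, u ≠ 1) ∧
  (∀ u ∈ A, ∀ v ∈ A, Preceq u v → u = v) ∧
  (∀ u ∈ A, ∀ v ∈ A, letters u = letters v ∧
    ∀ X : Set ℕ, X.Nonempty → X ⊆ letters u → deleteHom X u = deleteHom X v)

/-- Membership in `L_A`: a fully invariant congruence on `F` such that `A` is a union
of its classes. -/
def memLA (A : Set F) (θ : Con F) : Prop :=
  FullyInvariant θ ∧ ∀ u ∈ A, ∀ w : F, θ u w → w ∈ A

/-- The restriction of a congruence `θ` on `F` to the equivalence relation it induces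
on the subset `A`. -/
def restrictA (A : Set F) (θ : Con F) : Setoid ↥A :=
  Setoid.comap Subtype.val θ.toSetoid

/-- The smallest fully invariant congruence on `F` containing `S`. -/
def ficGen (S : Set (F × F)) : Con F :=
  sInf {θ : Con F | FullyInvariant θ ∧ ∀ p ∈ S, θ p.1 p.2}

/-- Saturation of `A` by a relation is inherited by the join of congruences: both congruences lie
below the syntactic congruence of `A`. -/
theorem Con.mem_of_sup_of_saturated {M : Type*} [Monoid M] {A : Set M} {θ₁ θ₂ : Con M}
    (h₁ : ∀ u ∈ A, ∀ w, θ₁ u w → w ∈ A) (h₂ : ∀ u ∈ A, ∀ w, θ₂ u w → w ∈ A) :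
    ∀ u ∈ A, ∀ w, (θ₁ ⊔ θ₂) u w → w ∈ A := by
  let σ : Con M :=
    { r := fun u w => ∀ a b : M, a * u * b ∈ A ↔ a * w * b ∈ A
      iseqv := ⟨fun _ _ _ => Iff.rfl, fun h a b => (h a b).symm,
        fun h k a b => (h a b).trans (k a b)⟩
      mul' := fun {u w x y} h k a b => by
        have h' := h a (x * b)
        have k' := k (a * w) b
        simp only [mul_assoc] at h' k' ⊢
        exact h'.trans k' }
  have le_syntactic {θ : Con M} (h : ∀ u ∈ A, ∀ w, θ u w → w ∈ A) : θ ≤ σ := by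
    intro u w huw a b
    have key : θ (a * u * b) (a * w * b) := θ.mul (θ.mul (θ.refl a) huw) (θ.refl b)
    exact ⟨fun hu => h _ hu _ key, fun hw => h _ hw _ (θ.symm key)⟩
  intro u hu w huw
  have hσ : σ u w := sup_le (le_syntactic h₁) (le_syntactic h₂) huw
  simpa using (hσ 1 1).1 (by simpa using hu)

theorem FullyInvariant.inf {θ₁ θ₂ : Con F} (h₁ : FullyInvariant θ₁) (h₂ : FullyInvariant θ₂) :
    FullyInvariant (θ₁ ⊓ θ₂) :=
  fun ξ u v h => ⟨h₁ ξ u v h.1, h₂ ξ u v h.2⟩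

theorem FullyInvariant.sup {θ₁ θ₂ : Con F} (h₁ : FullyInvariant θ₁) (h₂ : FullyInvariant θ₂) :
    FullyInvariant (θ₁ ⊔ θ₂) := by
  intro ξ u v h
  have hle : θ₁ ⊔ θ₂ ≤ (θ₁ ⊔ θ₂).comap ξ ξ.map_mul :=
    sup_le (fun {x y} hxy => (le_sup_left : θ₁ ≤ θ₁ ⊔ θ₂) (h₁ ξ x y hxy))
      (fun {x y} hxy => (le_sup_right : θ₂ ≤ θ₁ ⊔ θ₂) (h₂ ξ x y hxy))
  exact hle h

/-- If `A` is a good antichain and `θ₁, θ₂ ∈ L_A`, then `θ₁ ⊓ θ₂` and `θ₁ ⊔ θ₂`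
(computed in the lattice of congruences on `F`) are fully invariant congruences
belonging to `L_A`; in particular, `L_A` is a sublattice of the lattice of fully
invariant congruences on `F`. -/
theorem stmt2 (A : Set F) (hA : GoodAntichain A) (θ₁ θ₂ : Con F)
    (h1 : memLA A θ₁) (h2 : memLA A θ₂) :
    memLA A (θ₁ ⊓ θ₂) ∧ memLA A (θ₁ ⊔ θ₂) :=
  ⟨⟨h1.1.inf h2.1, fun u hu w h => h1.2 u hu w h.1⟩,
    ⟨h1.1.sup h2.1, Con.mem_of_sup_of_saturated h1.2 h2.2⟩⟩
end

section
/- Let A be a good antichain of words in F. The restriction map r : L_A → Setoid A sending θ to the equivalence relation θ|_A induced on A is a surjective lattice homomorphism: r(θ₁ ⊓ θ₂) = r(θ₁) ⊓ r(θ₂) and r(θ₁ ⊔ θ₂) = r(θ₁) ⊔ r(θ₂) for all θ₁, θ₂ ∈ L_A (meets and joins of congruences taken in the lattice of congruences on F), and every equivalence relation on A is of the form θ|_A for some θ ∈ L_A. -/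
/-- Two homomorphisms that agree on the letters of a word agree on the word. -/
theorem hom_eq_of_eq_on_letters {M : Type*} [Monoid M] (f g : F →* M) (w : F)
    (h : ∀ x ∈ letters w, f (FreeMonoid.of x) = g (FreeMonoid.of x)) : f w = g w := by
  induction w using FreeMonoid.inductionOn' with
  | one => simp
  | of_mul x w ih =>
    rw [map_mul, map_mul, h x (by simp [letters]), ih]
    intro y hy
    apply h
    simp only [letters, Set.mem_ofPred_eq, FreeMonoid.toList_of_mul, List.mem_cons] at hy ⊢
    exact Or.inr hy

/-- Deleting letters that `ξ` erases does not change the image under `ξ`. -/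
theorem map_deleteHom_of_erased (ξ : F →* F) (X : Set ℕ)
    (hX : ∀ x ∈ X, ξ (FreeMonoid.of x) = 1) (w : F) : ξ (deleteHom X w) = ξ w := by
  change (ξ.comp (deleteHom X)) w = ξ w
  apply hom_eq_of_eq_on_letters
  intro x _
  by_cases hx : x ∈ X
  · simp [deleteHom, hx, hX x hx]
  · simp [deleteHom, hx]

theorem Nonerasing.length_of_pos {ξ : F →* F} (hξ : Nonerasing ξ) (x : ℕ) :
    1 ≤ (ξ (FreeMonoid.of x)).length := by
  have h : (ξ (FreeMonoid.of x)).length ≠ 0 := fun h => hξ x (FreeMonoid.length_eq_zero.mp h)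
  omega

theorem Nonerasing.length_le {ξ : F →* F} (hξ : Nonerasing ξ) (w : F) :
    w.length ≤ (ξ w).length := by
  induction w using FreeMonoid.inductionOn' with
  | one => simp
  | of_mul x w ih =>
    have := hξ.length_of_pos x
    rw [map_mul, FreeMonoid.length_mul, FreeMonoid.length_mul, FreeMonoid.length_of]
    omega

/-- A nonerasing endomorphism that fixes a word fixes each of its letters. -/
theorem Nonerasing.fixes_letters {ξ : F →* F} (hξ : Nonerasing ξ) {w : F} (hw : ξ w = w) :
    ∀ x ∈ letters w, ξ (FreeMonoid.of x) = FreeMonoid.of x := by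
  induction w using FreeMonoid.inductionOn' with
  | one => intro x hx; simp [letters] at hx
  | of_mul y w ih =>
    rw [map_mul] at hw
    have hlen := congrArg FreeMonoid.length hw
    rw [FreeMonoid.length_mul, FreeMonoid.length_mul, FreeMonoid.length_of] at hlen
    have h1 := hξ.length_of_pos y
    have h2 := hξ.length_le w
    have hy : (ξ (FreeMonoid.of y)).length = (FreeMonoid.of y).length := by
      rw [FreeMonoid.length_of]; omega
    obtain ⟨hfix, hrest⟩ := List.append_inj (congrArg FreeMonoid.toList hw) hy
    intro x hx
    simp only [letters, Set.mem_ofPred_eq, FreeMonoid.toList_of_mul, List.mem_cons] at hx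
    rcases hx with rfl | hx
    · exact FreeMonoid.toList.injective hfix
    · exact ih (FreeMonoid.toList.injective hrest) x hx

/-- If a word of a good antichain is obtained by substituting into a member `p`, then the same
substitution into another member `q` either changes nothing or reproduces `q`. -/
theorem GoodAntichain.substitution_cases {A : Set F} (hA : GoodAntichain A) {p q : F}
    (hp : p ∈ A) (hq : q ∈ A) (a b : F) (ξ : F →* F) (h : a * ξ p * b ∈ A) :
    a * ξ q * b = a * ξ p * b ∨ (a * ξ p * b = p ∧ a * ξ q * b = q) := by
  obtain ⟨-, hanti, hgood⟩ := hA
  obtain ⟨hlet, hdel⟩ := hgood p hp q hq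
  by_cases hex : ∃ x ∈ letters p, ξ (FreeMonoid.of x) = 1
  · left
    obtain ⟨x, hx, hx1⟩ := hex
    have hpq := hdel {x} (Set.singleton_nonempty x) (Set.singleton_subset_iff.mpr hx)
    have herase : ∀ y ∈ ({x} : Set ℕ), ξ (FreeMonoid.of y) = 1 := by
      rintro y rfl
      exact hx1
    rw [← map_deleteHom_of_erased ξ {x} herase q, ← hpq, map_deleteHom_of_erased ξ {x} herase]
  · right
    push Not at hex
    classical
    let η : F →* F := FreeMonoid.lift fun x =>
      if ξ (FreeMonoid.of x) = 1 then FreeMonoid.of x else ξ (FreeMonoid.of x)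
    have hη : Nonerasing η := by
      intro x
      by_cases hx : ξ (FreeMonoid.of x) = 1
      · simp [η, hx]
      · simp [η, hx]
    have hηξ : ∀ x ∈ letters p, η (FreeMonoid.of x) = ξ (FreeMonoid.of x) := by
      intro x hx
      simp [η, hex x hx]
    have hηp : η p = ξ p := hom_eq_of_eq_on_letters η ξ p hηξ
    have hηq : η q = ξ q := hom_eq_of_eq_on_letters η ξ q (hlet ▸ hηξ)
    have hfix : p = a * η p * b :=
      (hanti p hp _ h ⟨a, b, η, hη, by rw [hηp]⟩).trans (by rw [hηp])
    have hlen := congrArg FreeMonoid.length hfix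
    rw [FreeMonoid.length_mul, FreeMonoid.length_mul] at hlen
    have hle := hη.length_le p
    have ha : a = 1 := FreeMonoid.length_eq_zero.mp (by omega)
    have hb : b = 1 := FreeMonoid.length_eq_zero.mp (by omega)
    subst ha hb
    rw [one_mul, mul_one] at hfix
    have hid : η q = q :=
      hom_eq_of_eq_on_letters η (MonoidHom.id F) q (hlet ▸ hη.fixes_letters hfix.symm)
    rw [← hηp, ← hηq, hid, ← hfix]
    simp

/-- The extension of an equivalence relation on `A` to all words, with the complement of `A`
as a single class. -/
def extendSetoid (A : Set F) (β : Setoid ↥A) : Setoid F where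
  r u v := (u ∈ A ↔ v ∈ A) ∧ ∀ (hu : u ∈ A) (hv : v ∈ A), β ⟨u, hu⟩ ⟨v, hv⟩
  iseqv :=
    { refl := fun _ => ⟨Iff.rfl, fun _ _ => β.refl _⟩
      symm := fun h => ⟨h.1.symm, fun hu hv => β.symm (h.2 hv hu)⟩
      trans := fun h k => ⟨h.1.trans k.1, fun hu hw =>
        β.trans (h.2 hu (h.1.mp hu)) (k.2 (h.1.mp hu) hw)⟩ }

/-- The largest fully invariant congruence contained in an equivalence relation. -/
def ficCore (s : Setoid F) : Con F where
  r u v := ∀ (a b : F) (ξ : F →* F), s (a * ξ u * b) (a * ξ v * b)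
  iseqv :=
    { refl := fun _ _ _ _ => s.refl _
      symm := fun h a b ξ => s.symm (h a b ξ)
      trans := fun h k a b ξ => s.trans (h a b ξ) (k a b ξ) }
  mul' := by
    intro w x y z h k a b ξ
    have h1 := h a (ξ y * b) ξ
    have h2 := k (a * ξ x) b ξ
    simp only [map_mul, mul_assoc] at h1 h2 ⊢
    exact s.trans h1 h2

theorem ficCore_fullyInvariant (s : Setoid F) : FullyInvariant (ficCore s) :=
  fun ξ _ _ h a b η => h a b (η.comp ξ)

theorem ficCore_le {s : Setoid F} {u v : F} (h : ficCore s u v) : s u v := by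
  simpa using h 1 1 (MonoidHom.id F)

theorem GoodAntichain.ficCore_extendSetoid {A : Set F} (hA : GoodAntichain A) (β : Setoid ↥A)
    {p q : ↥A} (h : β p q) : ficCore (extendSetoid A β) p q := by
  intro a b ξ
  by_cases hp : a * ξ p * b ∈ A
  · rcases hA.substitution_cases p.2 q.2 a b ξ hp with e | ⟨e₁, e₂⟩
    · rw [e]
    · rw [e₁, e₂]
      exact ⟨iff_of_true p.2 q.2, fun _ _ => h⟩
  · by_cases hq : a * ξ q * b ∈ A
    · rcases hA.substitution_cases q.2 p.2 a b ξ hq with e | ⟨e₁, e₂⟩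
      · rw [e]
      · rw [e₁, e₂]
        exact ⟨iff_of_true p.2 q.2, fun _ _ => h⟩
    · exact ⟨iff_of_false hp hq, fun hu => absurd hu hp⟩

/-- The join of two congruences in the lattice of equivalence relations is a congruence. -/
def conSetoidSup {M : Type*} [Monoid M] (c d : Con M) : Con M where
  toSetoid := c.toSetoid ⊔ d.toSetoid
  mul' := by
    intro w x y z h k
    have hleft : c.toSetoid ⊔ d.toSetoid ≤ (c.toSetoid ⊔ d.toSetoid).comap (x * ·) :=
      sup_le
        (fun u v e => (le_sup_left : c.toSetoid ≤ c.toSetoid ⊔ d.toSetoid) (c.mul (c.refl x) e))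
        (fun u v e => (le_sup_right : d.toSetoid ≤ c.toSetoid ⊔ d.toSetoid) (d.mul (d.refl x) e))
    have hright : c.toSetoid ⊔ d.toSetoid ≤ (c.toSetoid ⊔ d.toSetoid).comap (· * y) :=
      sup_le
        (fun u v e => (le_sup_left : c.toSetoid ≤ c.toSetoid ⊔ d.toSetoid) (c.mul e (c.refl y)))
        (fun u v e => (le_sup_right : d.toSetoid ≤ c.toSetoid ⊔ d.toSetoid) (d.mul e (d.refl y)))
    exact (c.toSetoid ⊔ d.toSetoid).trans (hright h) (hleft k)

theorem sup_le_conSetoidSup {M : Type*} [Monoid M] (c d : Con M) : c ⊔ d ≤ conSetoidSup c d :=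
  sup_le (fun {_ _} e => (le_sup_left : c.toSetoid ≤ c.toSetoid ⊔ d.toSetoid) e)
    (fun {_ _} e => (le_sup_right : d.toSetoid ≤ c.toSetoid ⊔ d.toSetoid) e)

/-- If `A` is a union of classes of `θ` then `θ` is contained in the extension of any equivalence
relation on `A` containing the restriction of `θ`. -/
theorem toSetoid_le_extendSetoid {A : Set F} {θ : Con F} {β : Setoid ↥A}
    (hθ : ∀ u ∈ A, ∀ w : F, θ u w → w ∈ A) (hβ : restrictA A θ ≤ β) :
    θ.toSetoid ≤ extendSetoid A β :=
  fun u v h => ⟨⟨fun hu => hθ u hu v h, fun hv => hθ v hv u (θ.symm h)⟩, fun _ _ => hβ h⟩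

/-- Restriction to a union of classes of both congruences preserves joins. -/
theorem restrictA_sup {A : Set F} {θ₁ θ₂ : Con F}
    (h₁ : ∀ u ∈ A, ∀ w : F, θ₁ u w → w ∈ A) (h₂ : ∀ u ∈ A, ∀ w : F, θ₂ u w → w ∈ A) :
    restrictA A (θ₁ ⊔ θ₂) = restrictA A θ₁ ⊔ restrictA A θ₂ := by
  apply le_antisymm
  · have key : θ₁.toSetoid ⊔ θ₂.toSetoid ≤ extendSetoid A (restrictA A θ₁ ⊔ restrictA A θ₂) :=
      sup_le (toSetoid_le_extendSetoid h₁ le_sup_left) (toSetoid_le_extendSetoid h₂ le_sup_right)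
    intro u v h
    exact (key (sup_le_conSetoidSup θ₁ θ₂ h)).2 u.2 v.2
  · apply sup_le
    · intro u v h
      exact (le_sup_left : θ₁ ≤ θ₁ ⊔ θ₂) h
    · intro u v h
      exact (le_sup_right : θ₂ ≤ θ₁ ⊔ θ₂) h

/-- For a good antichain `A`, the restriction map `θ ↦ θ|_A` from `L_A` to `Setoid A`
is a surjective lattice homomorphism. -/
theorem stmt3 (A : Set F) (hA : GoodAntichain A) :
    (∀ θ₁ θ₂ : Con F, memLA A θ₁ → memLA A θ₂ →
      restrictA A (θ₁ ⊓ θ₂) = restrictA A θ₁ ⊓ restrictA A θ₂ ∧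
      restrictA A (θ₁ ⊔ θ₂) = restrictA A θ₁ ⊔ restrictA A θ₂) ∧
    (∀ β : Setoid ↥A, ∃ θ : Con F, memLA A θ ∧ restrictA A θ = β) := by
  refine ⟨fun θ₁ θ₂ h₁ h₂ => ⟨rfl, restrictA_sup h₁.2 h₂.2⟩, fun β => ?_⟩
  refine ⟨ficCore (extendSetoid A β), ⟨ficCore_fullyInvariant _, ?_⟩, ?_⟩
  · exact fun u hu w h => (ficCore_le h).1.mp hu
  · ext p q
    exact ⟨fun h => (ficCore_le h).2 p.2 q.2, fun h => hA.ficCore_extendSetoid β h⟩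
end

section
/- Let A be a good antichain of words in F. For every equivalence relation β on A there exists a fully invariant congruence θ on F such that θ ≤ κ (θ is overcommutative), θ ∈ L_A, and the restriction of θ to A equals β. -/
lemma mem_letters_of_mul {x y : ℕ} {w : F} :
    y ∈ letters (FreeMonoid.of x * w) ↔ y = x ∨ y ∈ letters w := by
  simp [letters]

lemma MonoidHom.apply_eq_of_eqOn_letters {ξ η : F →* F} {w : F}
    (h : ∀ x ∈ letters w, ξ (FreeMonoid.of x) = η (FreeMonoid.of x)) : ξ w = η w := by
  induction w using FreeMonoid.inductionOn' with
  | one => simp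
  | of_mul x w ih =>
    rw [map_mul, map_mul, h x (mem_letters_of_mul.mpr (Or.inl rfl)),
      ih fun y hy => h y (mem_letters_of_mul.mpr (Or.inr hy))]

lemma MonoidHom.apply_deleteHom {ξ : F →* F} {X : Set ℕ}
    (h : ∀ x ∈ X, ξ (FreeMonoid.of x) = 1) (w : F) : ξ (deleteHom X w) = ξ w := by
  suffices ξ.comp (deleteHom X) = ξ from DFunLike.congr_fun this w
  refine FreeMonoid.hom_eq fun x => ?_
  by_cases hx : x ∈ X <;> simp [deleteHom, hx, h]

lemma length_le_length_apply {ξ : F →* F} {w : F}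
    (h : ∀ x ∈ letters w, ξ (FreeMonoid.of x) ≠ 1) : w.length ≤ (ξ w).length := by
  induction w using FreeMonoid.inductionOn' with
  | one => simp
  | of_mul x w ih =>
    have h₁ := ih fun y hy =>
      h y (mem_letters_of_mul.mpr (Or.inr hy))
    have h₂ : (ξ (FreeMonoid.of x)).length ≠ 0 := fun h₀ =>
      h x (mem_letters_of_mul.mpr (Or.inl rfl)) (FreeMonoid.length_eq_zero.mp h₀)
    rw [map_mul, FreeMonoid.length_mul, FreeMonoid.length_mul, FreeMonoid.length_of]
    omega

lemma apply_of_eq_of_apply_eq {ξ : F →* F} {w : F}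
    (h : ∀ x ∈ letters w, ξ (FreeMonoid.of x) ≠ 1) (hw : ξ w = w) :
    ∀ x ∈ letters w, ξ (FreeMonoid.of x) = FreeMonoid.of x := by
  induction w using FreeMonoid.inductionOn' with
  | one => simp [letters]
  | of_mul x w ih =>
    have h_tail : ∀ y ∈ letters w, ξ (FreeMonoid.of y) ≠ 1 := fun y hy =>
      h y (mem_letters_of_mul.mpr (Or.inr hy))
    have h₁ := length_le_length_apply h_tail
    have h₂ : (ξ (FreeMonoid.of x)).length ≠ 0 := fun h₀ =>
      h x (mem_letters_of_mul.mpr (Or.inl rfl)) (FreeMonoid.length_eq_zero.mp h₀)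
    rw [map_mul] at hw
    have h₃ := congrArg FreeMonoid.length hw
    rw [FreeMonoid.length_mul, FreeMonoid.length_mul, FreeMonoid.length_of] at h₃
    have h₄ : (ξ (FreeMonoid.of x)).length = (FreeMonoid.of x).length := by
      rw [FreeMonoid.length_of]; omega
    obtain ⟨h₅, h₆⟩ := List.append_inj (congrArg FreeMonoid.toList hw) h₄
    intro y hy
    rcases mem_letters_of_mul.mp hy with rfl | hy
    · exact h₅
    · exact ih h_tail h₆ y hy

lemma preceq_of_letters_ne {ξ : F →* F} {u : F}
    (h : ∀ x ∈ letters u, ξ (FreeMonoid.of x) ≠ 1) (a b : F) : Preceq u (a * ξ u * b) := by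
  classical
  refine ⟨a, b, FreeMonoid.lift fun x =>
    if x ∈ letters u then ξ (FreeMonoid.of x) else FreeMonoid.of x, fun x => ?_, ?_⟩
  · by_cases hx : x ∈ letters u
    · simpa [hx] using h x hx
    · simp [hx]
  · congr 2
    exact MonoidHom.apply_eq_of_eqOn_letters fun x hx => by simp [hx]

lemma occ_deleteHom {x : ℕ} {X : Set ℕ} (hx : x ∉ X) (w : F) :
    occ x (deleteHom X w) = occ x w := by
  have occ_mul : ∀ u v : F, occ x (u * v) = occ x u + occ x v := fun u v => by simp [occ]
  induction w using FreeMonoid.inductionOn' with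
  | one => simp
  | of_mul y w ih =>
    rw [map_mul, occ_mul, occ_mul, ih]
    by_cases hy : y ∈ X
    · have hyx : y ≠ x := fun e => hx (e ▸ hy)
      simp [deleteHom, hy, occ, hyx]
    · simp [deleteHom, hy]

lemma GoodAntichain.kappaRel {A : Set F} (hA : GoodAntichain A) {u v : F} (hu : u ∈ A)
    (hv : v ∈ A) : kappaRel u v := by
  intro x
  obtain ⟨h_letters, h_delete⟩ := hA.2.2 u hu v hv
  rcases (letters u \ {x}).eq_empty_or_nonempty with h | h
  · have h₁ : ∀ w, letters w = letters u → FreeMonoid.toList w = List.replicate w.length x := by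
      refine fun w hw => List.eq_replicate_iff.mpr ⟨rfl, fun y hy => ?_⟩
      by_contra hyx
      exact (h ▸ (⟨hw ▸ hy, hyx⟩ : y ∈ letters u \ {x}) : y ∈ (∅ : Set ℕ))
    have h₂ : ∀ s t : F, letters s = letters u → letters t = letters u →
        s.length ≤ t.length → Preceq s t := by
      refine fun s t hs ht hst => ⟨1, FreeMonoid.ofList (List.replicate (t.length - s.length) x),
        MonoidHom.id F, fun y => FreeMonoid.of_ne_one y, ?_⟩
      apply FreeMonoid.toList.injective
      simp only [one_mul, MonoidHom.id_apply, FreeMonoid.toList_mul, FreeMonoid.toList_ofList,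
        h₁ s hs, h₁ t ht, ← List.replicate_add]
      rw [Nat.add_sub_cancel' hst]
    rcases le_total u.length v.length with hl | hl
    · rw [hA.2.1 u hu v hv (h₂ u v rfl h_letters.symm hl)]
    · rw [hA.2.1 v hv u hu (h₂ v u h_letters.symm rfl hl)]
  · rw [← occ_deleteHom (X := letters u \ {x}) (by simp) u, h_delete _ h Set.sdiff_subset,
      occ_deleteHom (by simp)]

lemma kappaRel.map {u v : F} (h : kappaRel u v) (ξ : F →* F) : kappaRel (ξ u) (ξ v) := by
  have key : ∀ s t : List ℕ, s.Perm t →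
      (FreeMonoid.toList (ξ (FreeMonoid.ofList s))).Perm
        (FreeMonoid.toList (ξ (FreeMonoid.ofList t))) := by
    intro s t hst
    induction hst with
    | nil => exact List.Perm.refl _
    | cons x _ ih =>
      simp only [FreeMonoid.ofList_cons, map_mul, FreeMonoid.toList_mul]
      exact ih.append_left _
    | swap x y l =>
      simp only [FreeMonoid.ofList_cons, map_mul, FreeMonoid.toList_mul, ← List.append_assoc]
      exact List.perm_append_comm.append_right _
    | trans _ _ ih₁ ih₂ => exact ih₁.trans ih₂
  exact fun x => (key _ _ (List.perm_iff_count.mpr h)).count_eq x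

lemma kappaRel.mul {s t u v : F} (h : kappaRel s t) (h' : kappaRel u v) :
    kappaRel (s * u) (t * v) := fun x => by
  have h₁ := h x
  have h₂ := h' x
  simp only [occ, FreeMonoid.toList_mul, List.count_append] at h₁ h₂ ⊢
  rw [h₁, h₂]

/-- The partition of `F` whose blocks are the `β`-classes and the complement of `A`. -/
def blockSetoid {A : Set F} (β : Setoid A) : Setoid F where
  r u v := (u ∈ A ↔ v ∈ A) ∧ ∀ (hu : u ∈ A) (hv : v ∈ A), β ⟨u, hu⟩ ⟨v, hv⟩
  iseqv :=
    { refl := fun _ => ⟨Iff.rfl, fun _ _ => β.refl _⟩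
      symm := fun h => ⟨h.1.symm, fun hu hv => β.symm (h.2 hv hu)⟩
      trans := fun h h' =>
        ⟨h.1.trans h'.1, fun hu hv => β.trans (h.2 hu (h.1.mp hu)) (h'.2 (h.1.mp hu) hv)⟩ }

/-- The largest overcommutative fully invariant congruence contained in the equivalence `s`. -/
def invariantCore (s : Setoid F) : Con F where
  r u v := kappaRel u v ∧ ∀ (a b : F) (ξ : F →* F), s (a * ξ u * b) (a * ξ v * b)
  iseqv :=
    { refl := fun _ => ⟨fun _ => rfl, fun _ _ _ => s.refl _⟩
      symm := fun h => ⟨fun x => (h.1 x).symm, fun a b ξ => s.symm (h.2 a b ξ)⟩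
      trans := fun h h' => ⟨fun x => (h.1 x).trans (h'.1 x),
        fun a b ξ => s.trans (h.2 a b ξ) (h'.2 a b ξ)⟩ }
  mul' := fun {t t' u u'} h h' => ⟨h.1.mul h'.1, fun a b ξ => by
    have h₁ := h.2 a (ξ u * b) ξ
    have h₂ := h'.2 (a * ξ t') b ξ
    simp only [map_mul, mul_assoc] at h₁ h₂ ⊢
    exact s.trans h₁ h₂⟩

lemma fullyInvariant_invariantCore (s : Setoid F) : FullyInvariant (invariantCore s) :=
  fun ξ _ _ h => ⟨h.1.map ξ, fun a b η => h.2 a b (η.comp ξ)⟩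

lemma rel_of_invariantCore {s : Setoid F} {u v : F} (h : invariantCore s u v) : s u v := by
  simpa using h.2 1 1 (MonoidHom.id F)

lemma GoodAntichain.eq_or_eq_of_mem {A : Set F} (hA : GoodAntichain A) {u v : F} (hu : u ∈ A)
    (hv : v ∈ A) {a b : F} {ξ : F →* F} (h : a * ξ u * b ∈ A) :
    a * ξ v * b = a * ξ u * b ∨ (a * ξ u * b = u ∧ a * ξ v * b = v) := by
  obtain ⟨h_letters, h_delete⟩ := hA.2.2 u hu v hv
  by_cases h_ne : ∀ x ∈ letters u, ξ (FreeMonoid.of x) ≠ 1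
  · right
    have hw := hA.2.1 u hu _ h (preceq_of_letters_ne h_ne a b)
    have h₁ := length_le_length_apply h_ne
    have h₂ := congrArg FreeMonoid.length hw
    rw [FreeMonoid.length_mul, FreeMonoid.length_mul] at h₂
    obtain rfl : a = 1 := FreeMonoid.length_eq_zero.mp (by omega)
    obtain rfl : b = 1 := FreeMonoid.length_eq_zero.mp (by omega)
    rw [one_mul, mul_one] at hw ⊢
    refine ⟨hw.symm, ?_⟩
    rw [one_mul, mul_one]
    exact MonoidHom.apply_eq_of_eqOn_letters (η := MonoidHom.id F)
      fun x hx => apply_of_eq_of_apply_eq h_ne hw.symm x (h_letters ▸ hx)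
  · left
    push Not at h_ne
    obtain ⟨x, hx, hξ⟩ := h_ne
    have h_erase : ∀ y ∈ ({x} : Set ℕ), ξ (FreeMonoid.of y) = 1 := by simpa using hξ
    rw [← MonoidHom.apply_deleteHom h_erase v, ← MonoidHom.apply_deleteHom h_erase u,
      h_delete {x} (Set.singleton_nonempty x) (Set.singleton_subset_iff.mpr hx)]

lemma GoodAntichain.invariantCore_blockSetoid {A : Set F} (hA : GoodAntichain A) {β : Setoid A}
    {u v : A} (h : β u v) : invariantCore (blockSetoid β) u v := by
  refine ⟨hA.kappaRel u.2 v.2, fun a b ξ => ?_⟩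
  have key : ∀ {s t : A}, β s t → a * ξ s * b ∈ A →
      blockSetoid β (a * ξ s * b) (a * ξ t * b) := by
    intro s t hst hs
    rcases hA.eq_or_eq_of_mem s.2 t.2 hs with e | ⟨e₁, e₂⟩
    · rw [e]
    · rw [e₁, e₂]
      exact ⟨iff_of_true s.2 t.2, fun _ _ => hst⟩
  by_cases hu : a * ξ u * b ∈ A
  · exact key h hu
  by_cases hv : a * ξ v * b ∈ A
  · exact (blockSetoid β).symm (key (β.symm h) hv)
  · exact ⟨iff_of_false hu hv, fun h' => absurd h' hu⟩

/-- For a good antichain `A` and any equivalence relation `β` on `A` there is an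
overcommutative fully invariant congruence `θ ∈ L_A` whose restriction to `A` is `β`. -/
theorem stmt4 (A : Set F) (hA : GoodAntichain A) (β : Setoid ↥A) :
    ∃ θ : Con F, FullyInvariant θ ∧ (∀ u v : F, θ u v → kappaRel u v) ∧
      memLA A θ ∧ restrictA A θ = β := by
  have h_inv := fullyInvariant_invariantCore (blockSetoid β)
  refine ⟨invariantCore (blockSetoid β), h_inv, fun _ _ h => h.1,
    ⟨h_inv, fun u hu w h => (rel_of_invariantCore h).1.mp hu⟩, ?_⟩
  ext u v
  exact ⟨fun h => (rel_of_invariantCore h).2 u.2 v.2, hA.invariantCore_blockSetoid⟩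
end

section
/- For every natural number n there exist a sublattice S of the lattice of congruences on F, all of whose members are overcommutative fully invariant congruences, and a surjective lattice homomorphism from S onto the partition lattice Setoid (Fin n). -/
/-- In the congruence lattice of a monoid, joins are joins of equivalence relations. -/
lemma con_toSetoid_sup {M : Type*} [Monoid M] (c d : Con M) :
    (c ⊔ d).toSetoid = c.toSetoid ⊔ d.toSetoid := by
  set s := c.toSetoid ⊔ d.toSetoid with hs
  have hc : c.toSetoid ≤ s := le_sup_left
  have hd : d.toSetoid ≤ s := le_sup_right
  have right (z : M) : s ≤ Setoid.comap (· * z) s :=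
    sup_le (fun _ _ h => hc (c.mul h (c.refl z))) (fun _ _ h => hd (d.mul h (d.refl z)))
  have left (z : M) : s ≤ Setoid.comap (z * ·) s :=
    sup_le (fun _ _ h => hc (c.mul (c.refl z) h)) (fun _ _ h => hd (d.mul (d.refl z) h))
  let e : Con M :=
    { toSetoid := s
      mul' := fun {_ x y _} h₁ h₂ => s.trans' (right y h₁) (left x h₂) }
  have he : c ⊔ d ≤ e := sup_le (fun _ _ h => hc h) (fun _ _ h => hd h)
  refine le_antisymm (fun x y h => he h) (sup_le (fun x y h => ?_) (fun x y h => ?_))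
  · exact (le_sup_left : c ≤ c ⊔ d) h
  · exact (le_sup_right : d ≤ c ⊔ d) h

lemma occ_mul (x : ℕ) (u v : F) : occ x (u * v) = occ x u + occ x v :=
  List.count_append

lemma occ_pow (x : ℕ) (u : F) (k : ℕ) : occ x (u ^ k) = k * occ x u := by
  induction k with
  | zero => simp [occ]
  | succ k ih => rw [pow_succ, occ_mul, ih]; ring

lemma length_pow_word (u : F) (k : ℕ) : (u ^ k).length = k * u.length := by
  induction k with
  | zero => simp
  | succ k ih => rw [pow_succ, FreeMonoid.length_mul, ih]; ring

/-- The commutativity congruence as a congruence on `F`. -/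
def kappaCon : Con F where
  r := kappaRel
  iseqv := ⟨fun _ _ => rfl, fun h x => (h x).symm, fun h h' x => (h x).trans (h' x)⟩
  mul' := fun h h' x => by rw [occ_mul, occ_mul, h x, h' x]

lemma FullyInvariant.sup_s10 {c d : Con F} (hc : FullyInvariant c) (hd : FullyInvariant d) :
    FullyInvariant (c ⊔ d) := by
  intro ξ
  have h : c ⊔ d ≤ Con.comap ξ ξ.map_mul (c ⊔ d) :=
    sup_le (fun _ _ h => (le_sup_left : c ≤ c ⊔ d) (hc ξ _ _ h))
      (fun _ _ h => (le_sup_right : d ≤ c ⊔ d) (hd ξ _ _ h))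
  exact fun u v huv => h huv

section Family

variable {ι : Type*} (w : ι → F)

/-- The equivalence relation on `F` whose classes are the sets `{w j | R i j}` together with
the complement of the range of `w` (when `w` is injective). -/
def familySetoid (R : Setoid ι) : Setoid F where
  r u v := ∀ i, (∃ j, R i j ∧ u = w j) ↔ (∃ j, R i j ∧ v = w j)
  iseqv := ⟨fun _ _ => Iff.rfl, fun h i => (h i).symm, fun h h' i => (h i).trans (h' i)⟩

variable {w}

lemma exists_of_familySetoid {R : Setoid ι} {i : ι} {v : F}
    (h : familySetoid w R (w i) v) : ∃ j, R i j ∧ v = w j :=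
  (h i).1 ⟨i, R.refl' i, rfl⟩

lemma familySetoid_apply_iff (hw : Function.Injective w) {R : Setoid ι} {i j : ι} :
    familySetoid w R (w i) (w j) ↔ R i j := by
  constructor
  · intro h
    obtain ⟨k, hk, e⟩ := exists_of_familySetoid h
    rwa [hw e]
  · intro h k
    constructor
    · rintro ⟨l, hl, e⟩
      exact ⟨j, R.trans' hl (hw e ▸ h), rfl⟩
    · rintro ⟨l, hl, e⟩
      exact ⟨i, R.trans' hl (hw e ▸ R.symm' h), rfl⟩

lemma le_familySetoid {θ : Con F} (hθ : ∀ i v, θ (w i) v → ∃ j, v = w j) {R : Setoid ι}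
    (hR : Setoid.comap w θ.toSetoid ≤ R) : θ.toSetoid ≤ familySetoid w R := by
  have key : ∀ u v, θ u v → ∀ i, (∃ j, R i j ∧ u = w j) → ∃ j, R i j ∧ v = w j := by
    rintro _ v h i ⟨j, hj, rfl⟩
    obtain ⟨k, rfl⟩ := hθ j v h
    exact ⟨k, R.trans' hj (hR h), rfl⟩
  exact fun u v h i => ⟨key u v h i, key v u (θ.symm h) i⟩

/-- If the range of `w` is a union of classes of `c` and of `d`, then the restriction of
`c ⊔ d` to the family `w` is described by the join of the two restrictions. -/
lemma sup_le_familySetoid {c d : Con F} (hc : ∀ i v, c (w i) v → ∃ j, v = w j)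
    (hd : ∀ i v, d (w i) v → ∃ j, v = w j) :
    (c ⊔ d).toSetoid ≤
      familySetoid w (Setoid.comap w c.toSetoid ⊔ Setoid.comap w d.toSetoid) := by
  rw [con_toSetoid_sup]
  exact sup_le (le_familySetoid hc le_sup_left) (le_familySetoid hd le_sup_right)

variable (w)

/-- The lattice of overcommutative fully invariant congruences for which the range of `w` is
a union of classes. -/
def saturatingSublattice : Sublattice (Con F) where
  carrier := {θ | FullyInvariant θ ∧ θ ≤ kappaCon ∧ ∀ i v, θ (w i) v → ∃ j, v = w j}
  supClosed' := by
    rintro c ⟨hc, hcκ, hcw⟩ d ⟨hd, hdκ, hdw⟩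
    refine ⟨hc.sup_s10 hd, sup_le hcκ hdκ, fun i v h => ?_⟩
    obtain ⟨j, -, hj⟩ := exists_of_familySetoid (sup_le_familySetoid hcw hdw h)
    exact ⟨j, hj⟩
  infClosed' := by
    rintro c ⟨hc, hcκ, hcw⟩ d ⟨hd, -, -⟩
    exact ⟨fun ξ u v h => ⟨hc ξ u v h.1, hd ξ u v h.2⟩, inf_le_left.trans hcκ,
      fun i v h => hcw i v h.1⟩

variable {w}

/-- Restriction of congruences to an injective family of words. -/
def restrictFamily (hw : Function.Injective w) :
    LatticeHom (saturatingSublattice w) (Setoid ι) where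
  toFun θ := Setoid.comap w θ.1.toSetoid
  map_sup' := by
    rintro ⟨c, -, -, hc⟩ ⟨d, -, -, hd⟩
    refine le_antisymm (fun i j h => ?_) (sup_le (fun i j h => ?_) (fun i j h => ?_))
    · exact (familySetoid_apply_iff hw).1 (sup_le_familySetoid hc hd h)
    · exact (le_sup_left : c ≤ c ⊔ d) h
    · exact (le_sup_right : d ≤ c ⊔ d) h
  map_inf' _ _ := rfl

end Family

/-- The largest fully invariant congruence contained in an equivalence relation on `F`. -/
def fullyInvariantCore (s : Setoid F) : Con F where
  r u v := ∀ (a b : F) (ξ : F →* F), s (a * ξ u * b) (a * ξ v * b)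
  iseqv := ⟨fun _ _ _ _ => s.refl' _, fun h a b ξ => s.symm' (h a b ξ),
    fun h h' a b ξ => s.trans' (h a b ξ) (h' a b ξ)⟩
  mul' := by
    intro u v x y h h' a b ξ
    have h₁ := h a (ξ x * b) ξ
    have h₂ := h' (a * ξ v) b ξ
    simp only [map_mul, mul_assoc] at h₁ h₂ ⊢
    exact s.trans' h₁ h₂

lemma fullyInvariantCore_le (s : Setoid F) : (fullyInvariantCore s).toSetoid ≤ s := by
  intro u v h
  simpa using h 1 1 (MonoidHom.id F)

lemma fullyInvariant_core (s : Setoid F) : FullyInvariant (fullyInvariantCore s) :=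
  fun ξ _ _ h a b η => h a b (η.comp ξ)

/-- The word `x ^ (i + 1) * y * x ^ (n - i)` evaluated at words `p` and `q`. -/
def splitPower (n : ℕ) (p q : F) (i : Fin n) : F :=
  p ^ (i.1 + 1) * q * p ^ (n - i.1)

/-- The words `x ^ (i + 1) * y * x ^ (n - i)`, where `x` and `y` are two distinct letters. -/
def splitWord (n : ℕ) : Fin n → F :=
  splitPower n (FreeMonoid.of 0) (FreeMonoid.of 1)

lemma map_splitWord {n : ℕ} (ξ : F →* F) (i : Fin n) :
    ξ (splitWord n i) = splitPower n (ξ (FreeMonoid.of 0)) (ξ (FreeMonoid.of 1)) i := by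
  simp [splitWord, splitPower]

lemma toList_of_pow (c k : ℕ) :
    FreeMonoid.toList (FreeMonoid.of c ^ k) = List.replicate k c := by
  induction k with
  | zero => rfl
  | succ k ih => rw [pow_succ, FreeMonoid.toList_mul, ih, List.replicate_succ']; rfl

lemma toList_splitPower_of {n : ℕ} (c d : ℕ) (i : Fin n) :
    FreeMonoid.toList (splitPower n (FreeMonoid.of c) (FreeMonoid.of d) i) =
      List.replicate (i.1 + 1) c ++ d :: List.replicate (n - i.1) c := by
  simp [splitPower, FreeMonoid.toList_mul, toList_of_pow]

lemma splitWord_injective (n : ℕ) : Function.Injective (splitWord n) := by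
  intro i j h
  have h' := congrArg (fun u => (FreeMonoid.toList u).idxOf 1) h
  simp only [splitWord, toList_splitPower_of] at h'
  rw [List.idxOf_append_of_notMem (by simp), List.idxOf_append_of_notMem (by simp)] at h'
  simp at h'
  exact Fin.ext h'

lemma kappaRel_splitPower {n : ℕ} (p q : F) (i j : Fin n) :
    kappaRel (splitPower n p q i) (splitPower n p q j) := by
  intro x
  simp only [splitPower, occ_mul, occ_pow]
  have hi : i.1 + 1 + (n - i.1) = n + 1 := by omega
  have hj : j.1 + 1 + (n - j.1) = n + 1 := by omega
  linear_combination occ x p * (hi.trans hj.symm)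

lemma splitPower_one_left {n : ℕ} (q : F) (i : Fin n) : splitPower n 1 q i = q := by
  simp [splitPower]

lemma splitPower_one_right {n : ℕ} (p : F) (i : Fin n) :
    splitPower n p 1 i = p ^ (n + 1) := by
  rw [splitPower, mul_one, ← pow_add]
  congr 1
  omega

lemma length_splitPower {n : ℕ} (p q : F) (i : Fin n) :
    (splitPower n p q i).length = (n + 1) * p.length + q.length := by
  simp only [splitPower, FreeMonoid.length_mul, length_pow_word]
  have hi : i.1 + 1 + (n - i.1) = n + 1 := by omega
  linear_combination p.length * hi

/-- The words `splitWord n i` form an antichain for nonerasing substitutions, and the only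
substitution witnessing a comparison is the trivial one. -/
lemma eq_of_mul_splitPower_mul {n : ℕ} {a b p q : F} {i k : Fin n} (hp : p ≠ 1) (hq : q ≠ 1)
    (h : a * splitPower n p q i * b = splitWord n k) :
    a = 1 ∧ b = 1 ∧ p = FreeMonoid.of 0 ∧ q = FreeMonoid.of 1 := by
  have hlen := congrArg FreeMonoid.length h
  simp only [splitWord, FreeMonoid.length_mul, length_splitPower, FreeMonoid.length_of] at hlen
  have hp' : p.length ≠ 0 := fun e => hp (FreeMonoid.length_eq_zero.1 e)
  have hq' : q.length ≠ 0 := fun e => hq (FreeMonoid.length_eq_zero.1 e)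
  have hp1 : p.length = 1 := by
    by_contra hne
    have : (n + 1) * 2 ≤ (n + 1) * p.length := Nat.mul_le_mul_left _ (by omega)
    omega
  rw [hp1] at hlen
  obtain rfl := FreeMonoid.length_eq_zero.1 (show a.length = 0 by omega)
  obtain rfl := FreeMonoid.length_eq_zero.1 (show b.length = 0 by omega)
  obtain ⟨c, rfl⟩ := FreeMonoid.length_eq_one.1 hp1
  obtain ⟨d, rfl⟩ := FreeMonoid.length_eq_one.1 (show q.length = 1 by omega)
  have hl := congrArg FreeMonoid.toList h
  rw [one_mul, mul_one, splitWord, toList_splitPower_of, toList_splitPower_of] at hl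
  have hc : c = 0 := by
    simp only [List.replicate_succ, List.cons_append, List.cons.injEq] at hl
    exact hl.1
  subst hc
  have hd : 1 ∈ List.replicate (i.1 + 1) 0 ++ d :: List.replicate (n - i.1) 0 := by
    rw [hl]; simp
  have hd' : 1 = d := by simpa using hd
  subst hd'
  exact ⟨rfl, rfl, rfl, rfl⟩

lemma familySetoid_splitPower {n : ℕ} {R : Setoid (Fin n)} {i j : Fin n} (hij : R i j)
    (a b p q : F) :
    familySetoid (splitWord n) R (a * splitPower n p q i * b) (a * splitPower n p q j * b) := by
  by_cases hp : p = 1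
  · subst hp
    rw [splitPower_one_left, splitPower_one_left]
  by_cases hq : q = 1
  · subst hq
    rw [splitPower_one_right, splitPower_one_right]
  have key : ∀ i j : Fin n, R i j → ∀ l,
      (∃ k, R l k ∧ a * splitPower n p q i * b = splitWord n k) →
      ∃ k, R l k ∧ a * splitPower n p q j * b = splitWord n k := by
    rintro i j hij l ⟨k, hlk, h⟩
    obtain ⟨rfl, rfl, rfl, rfl⟩ := eq_of_mul_splitPower_mul hp hq h
    rw [one_mul, mul_one] at h ⊢
    obtain rfl := splitWord_injective n h
    exact ⟨j, R.trans' hlk hij, rfl⟩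
  exact fun l => ⟨key i j hij l, key j i (R.symm' hij) l⟩

lemma restrictFamily_splitWord_surjective (n : ℕ) :
    Function.Surjective (restrictFamily (splitWord_injective n)) := by
  intro R
  have hle := fullyInvariantCore_le (kappaCon.toSetoid ⊓ familySetoid (splitWord n) R)
  refine ⟨⟨fullyInvariantCore (kappaCon.toSetoid ⊓ familySetoid (splitWord n) R),
    fullyInvariant_core _, fun _ _ h => (hle h).1, fun i v h => ?_⟩, ?_⟩
  · obtain ⟨j, -, hj⟩ := exists_of_familySetoid (hle h).2
    exact ⟨j, hj⟩
  · refine le_antisymm (fun i j h => ?_) (fun i j h a b ξ => ?_)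
    · exact (familySetoid_apply_iff (splitWord_injective n)).1 (hle h).2
    · rw [map_splitWord, map_splitWord]
      refine ⟨?_, familySetoid_splitPower h a b _ _⟩
      exact kappaCon.mul (kappaCon.mul (kappaCon.refl a) (kappaRel_splitPower _ _ i j))
        (kappaCon.refl b)

/-- For every `n` there are a sublattice `S` of the lattice of congruences on `F`, all
of whose members are overcommutative fully invariant congruences, and a surjective
lattice homomorphism from `S` onto the partition lattice `Setoid (Fin n)`. -/
theorem stmt10 (n : ℕ) :
    ∃ S : Sublattice (Con F),
      (∀ θ ∈ S, FullyInvariant θ ∧ ∀ u v : F, θ u v → kappaRel u v) ∧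
      ∃ f : LatticeHom ↥S (Setoid (Fin n)), Function.Surjective f := by
  exact ⟨saturatingSublattice (splitWord n), fun θ hθ => ⟨hθ.1, fun _ _ h => hθ.2.1 h⟩,
    restrictFamily (splitWord_injective n), restrictFamily_splitWord_surjective n⟩
end
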